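/- Let Ψ : (0,1] → (0,∞) be decreasing such that s ↦ sΨ(s) is increasing on (0,1], with the normalization ∫₀¹ ds/(sΨ(s)) = 1. Then there exists a constant c = c(Ψ) > 0 such that the following holds. Let N₁, N₂ be distribution functions with ∫₀^∞ N₁(t) dt > 0 and ∫₀^∞ N₂(t) dt > 0, let f₁, f₂ ∈ ℝ, and set f = (f₁+f₂)/2 and N = (N₁+N₂)/2. Then (1/2)(B̃(f₁, N₁) + B̃(f₂, N₂)) − B̃(f, N) ≥ (c/4)·(f₁ − f)²/n_Ψ(N), where if n_Ψ(N) = ∞ the right-hand side is interpreted as 0. -/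

import Mathlib

open MeasureTheory

/-- `n_Ψ(N) = ∫₀^∞ N(t)Ψ(N(t)) dt`, integrand taken to be `0` where `N(t) = 0`.
(The Bochner integral is `0` when the integrand is not integrable, which implements the
convention that the right-hand side below is `0` when `n_Ψ(N) = ∞`.) -/
noncomputable def nPsi (Ψ N : ℝ → ℝ) : ℝ :=
  ∫ t in Set.Ioi (0:ℝ), (if N t = 0 then 0 else N t * Ψ (N t))

/-- `m(s) = ∫₀^s (s−σ)/φ(σ) dσ` where `φ(σ) = σΨ(σ)`. -/
noncomputable def mFun (Ψ : ℝ → ℝ) (s : ℝ) : ℝ :=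
  ∫ σ in Set.Ioo (0:ℝ) s, (s - σ) / (σ * Ψ σ)

/-- `u(N) = ∫₀^∞ (2N(t) − m(N(t))) dt`. -/
noncomputable def uFun (Ψ N : ℝ → ℝ) : ℝ :=
  ∫ t in Set.Ioi (0:ℝ), (2 * N t - mFun Ψ (N t))

/-- The Bellman function `B̃(f, N) = f²/u(N)`. -/
noncomputable def Btilde (Ψ : ℝ → ℝ) (f : ℝ) (N : ℝ → ℝ) : ℝ := f ^ 2 / uFun Ψ N

/-- A distribution function: decreasing `N : [0,∞) → [0,1]` with `∫₀^∞ N < ∞`. -/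
def IsDistFun (N : ℝ → ℝ) : Prop :=
  AntitoneOn N (Set.Ici 0) ∧ (∀ t, 0 ≤ t → N t ∈ Set.Icc (0:ℝ) 1) ∧
    MeasureTheory.IntegrableOn N (Set.Ioi 0)

open Set

/-- The second antiderivative of a weight `w` on `(0, 1)`, extended to all of `ℝ`. -/
noncomputable def secondPrimitive (w : ℝ → ℝ) (s : ℝ) : ℝ :=
  ∫ σ in Ioo (0:ℝ) 1, max (s - σ) 0 * w σ

section SecondPrimitive

variable {w : ℝ → ℝ}

theorem integrableOn_posPart_mul (hw : IntegrableOn w (Ioo 0 1)) (s : ℝ) :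
    IntegrableOn (fun σ => max (s - σ) 0 * w σ) (Ioo 0 1) := by
  refine Integrable.bdd_mul (c := |s| + 1) hw
    (by fun_prop : Continuous fun σ : ℝ => max (s - σ) 0).aestronglyMeasurable ?_
  refine (ae_restrict_mem measurableSet_Ioo).mono fun σ hσ => ?_
  rw [Real.norm_eq_abs, abs_of_nonneg (le_max_right _ _)]
  exact max_le (by linarith [hσ.1, le_abs_self s]) (by positivity)

theorem secondPrimitive_mono (hw : IntegrableOn w (Ioo 0 1)) (h0 : ∀ σ ∈ Ioo (0:ℝ) 1, 0 ≤ w σ) :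
    Monotone (secondPrimitive w) := by
  intro s t hst
  refine setIntegral_mono_on (integrableOn_posPart_mul hw s) (integrableOn_posPart_mul hw t)
    measurableSet_Ioo fun σ hσ => ?_
  exact mul_le_mul_of_nonneg_right (max_le_max (by linarith) le_rfl) (h0 σ hσ)

theorem secondPrimitive_sub_le (hw : IntegrableOn w (Ioo 0 1))
    (h0 : ∀ σ ∈ Ioo (0:ℝ) 1, 0 ≤ w σ) (h1 : ∫ σ in Ioo (0:ℝ) 1, w σ = 1) {s t : ℝ}
    (hst : s ≤ t) : secondPrimitive w t - secondPrimitive w s ≤ t - s := by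
  have hle : secondPrimitive w t ≤
      ∫ σ in Ioo (0:ℝ) 1, (max (s - σ) 0 * w σ + (t - s) * w σ) := by
    refine setIntegral_mono_on (integrableOn_posPart_mul hw t)
      ((integrableOn_posPart_mul hw s).add (hw.const_mul _)) measurableSet_Ioo fun σ hσ => ?_
    rw [← add_mul]
    refine mul_le_mul_of_nonneg_right (max_le ?_ ?_) (h0 σ hσ)
    · linarith [le_max_left (s - σ) 0]
    · linarith [le_max_right (s - σ) 0]
  rw [integral_add (integrableOn_posPart_mul hw s) (hw.const_mul _), integral_const_mul, h1] at hle
  change _ ≤ secondPrimitive w s + _ at hle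
  linarith

theorem secondPrimitive_zero : secondPrimitive w 0 = 0 := by
  refine setIntegral_eq_zero_of_forall_eq_zero fun σ hσ => ?_
  rw [max_eq_right (by linarith [hσ.1]), zero_mul]

theorem continuous_secondPrimitive (hw : IntegrableOn w (Ioo 0 1))
    (h0 : ∀ σ ∈ Ioo (0:ℝ) 1, 0 ≤ w σ) (h1 : ∫ σ in Ioo (0:ℝ) 1, w σ = 1) :
    Continuous (secondPrimitive w) := by
  refine (LipschitzWith.of_le_add fun s t => ?_).continuous
  rw [Real.dist_eq]
  rcases le_total s t with hst | hst
  · linarith [secondPrimitive_mono hw h0 hst, abs_nonneg (s - t)]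
  · linarith [secondPrimitive_sub_le hw h0 h1 hst, le_abs_self (s - t)]

theorem le_secondPrimitive_midpoint_gap (hw : IntegrableOn w (Ioo 0 1))
    (h0 : ∀ σ ∈ Ioo (0:ℝ) 1, 0 ≤ w σ) {a b : ℝ} (ha : 0 ≤ a) (hab : a ≤ b) (hb : b ≤ 1)
    {k : ℝ} (hk : ∀ σ ∈ Ioo a ((a + b) / 2), k ≤ w σ) :
    k * ((b - a) / 2) ^ 2 / 4 ≤
      (secondPrimitive w a + secondPrimitive w b) / 2 - secondPrimitive w ((a + b) / 2) := by
  have hia := integrableOn_posPart_mul hw a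
  have hib := integrableOn_posPart_mul hw b
  have hix := integrableOn_posPart_mul hw ((a + b) / 2)
  have him : IntegrableOn (fun σ => (max (a - σ) 0 * w σ + max (b - σ) 0 * w σ) / 2)
      (Ioo 0 1) := (hia.add hib).div_const 2
  have hi : IntegrableOn (fun σ => (max (a - σ) 0 * w σ + max (b - σ) 0 * w σ) / 2
      - max ((a + b) / 2 - σ) 0 * w σ) (Ioo 0 1) := him.sub hix
  have heq : (secondPrimitive w a + secondPrimitive w b) / 2 - secondPrimitive w ((a + b) / 2) =
      ∫ σ in Ioo (0:ℝ) 1, ((max (a - σ) 0 * w σ + max (b - σ) 0 * w σ) / 2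
        - max ((a + b) / 2 - σ) 0 * w σ) := by
    rw [integral_sub him hix, integral_div, integral_add hia hib]
    rfl
  have hsub : Ioo a ((a + b) / 2) ⊆ Ioo (0:ℝ) 1 := by
    rintro σ ⟨h1, h2⟩
    exact ⟨by linarith, by linarith⟩
  rw [heq]
  calc k * ((b - a) / 2) ^ 2 / 4 = ∫ σ in Ioo a ((a + b) / 2), (σ - a) / 2 * k := by
        rw [← integral_Ioc_eq_integral_Ioo, ← intervalIntegral.integral_of_le (by linarith),
          intervalIntegral.integral_mul_const, intervalIntegral.integral_div,
          intervalIntegral.integral_sub (by simp) (by simp), integral_id,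
          intervalIntegral.integral_const, smul_eq_mul]
        ring
    _ ≤ ∫ σ in Ioo a ((a + b) / 2), ((max (a - σ) 0 * w σ + max (b - σ) 0 * w σ) / 2
        - max ((a + b) / 2 - σ) 0 * w σ) := by
        refine setIntegral_mono_on ?_ (hi.mono_set hsub) measurableSet_Ioo fun σ hσ => ?_
        · exact (Continuous.integrableOn_Icc (by fun_prop)).mono_set Ioo_subset_Icc_self
        · have h3 := hk σ hσ
          obtain ⟨h1, h2⟩ := hσ
          rw [max_eq_right (by linarith : a - σ ≤ 0), max_eq_left (by linarith : 0 ≤ b - σ),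
            max_eq_left (by linarith : 0 ≤ (a + b) / 2 - σ)]
          nlinarith
    _ ≤ _ := by
        refine setIntegral_mono_set hi ?_ hsub.eventuallyLE
        refine (ae_restrict_mem measurableSet_Ioo).mono fun σ hσ => ?_
        have h1 : 2 * max ((a + b) / 2 - σ) 0 ≤ max (a - σ) 0 + max (b - σ) 0 := by
          rcases max_cases ((a + b) / 2 - σ) 0 with h | h <;> rw [h.1] <;>
          linarith [le_max_left (a - σ) 0, le_max_right (a - σ) 0, le_max_left (b - σ) 0,
            le_max_right (b - σ) 0]
        have h2 := mul_le_mul_of_nonneg_right h1 (h0 σ hσ)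
        simp only [Pi.zero_apply]
        linarith

end SecondPrimitive

theorem mFun_eq_secondPrimitive (Ψ : ℝ → ℝ) {s : ℝ} (hs : s ≤ 1) :
    mFun Ψ s = secondPrimitive (fun σ => (σ * Ψ σ)⁻¹) s := by
  have hsub : Ioo 0 s ⊆ Ioo (0:ℝ) 1 := Ioo_subset_Ioo_right hs
  rw [mFun, secondPrimitive, setIntegral_eq_of_subset_of_forall_sdiff_eq_zero measurableSet_Ioo hsub]
  · refine setIntegral_congr_fun measurableSet_Ioo fun σ hσ => ?_
    rw [max_eq_left (by linarith [hσ.2]), div_eq_mul_inv]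
  · rintro σ ⟨h1, h2⟩
    have : s ≤ σ := by
      by_contra! h
      exact h2 ⟨h1.1, h⟩
    rw [max_eq_right (by linarith), zero_mul]

/-- A Cauchy–Schwarz inequality in which the two factors are only compared pointwise. -/
theorem sq_integral_le_of_sq_le_mul {α : Type*} [MeasurableSpace α] {μ : Measure α}
    {g p q : α → ℝ} (hg : Integrable g μ) (hp : Integrable p μ) (hq : Integrable q μ)
    (hp0 : 0 ≤ᵐ[μ] p) (hq0 : 0 ≤ᵐ[μ] q) (h : ∀ᵐ x ∂μ, g x ^ 2 ≤ p x * q x)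
    (hpos : 0 < ∫ x, q x ∂μ) :
    (∫ x, g x ∂μ) ^ 2 ≤ (∫ x, p x ∂μ) * ∫ x, q x ∂μ := by
  have hP : 0 ≤ ∫ x, p x ∂μ := integral_nonneg_of_ae hp0
  have key : ∀ l : ℝ, 0 < l →
      |∫ x, g x ∂μ| ≤ (l * ∫ x, p x ∂μ + (∫ x, q x ∂μ) / l) / 2 := by
    intro l hl
    have hi : Integrable (fun x => (l * p x + q x / l) / 2) μ :=
      ((hp.const_mul l).add (hq.div_const l)).div_const 2
    calc |∫ x, g x ∂μ| ≤ ∫ x, |g x| ∂μ := abs_integral_le_integral_abs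
      _ ≤ ∫ x, (l * p x + q x / l) / 2 ∂μ := by
        refine integral_mono_ae hg.abs hi ?_
        filter_upwards [hp0, hq0, h] with x hpx hqx hx
        simp only [Pi.zero_apply] at hpx hqx
        refine abs_le_of_sq_le_sq (hx.trans ?_) (by positivity)
        have : p x * q x = (l * p x) * (q x / l) := by field_simp
        rw [this]
        nlinarith [sq_nonneg (l * p x - q x / l)]
      _ = _ := by
        rw [integral_div, integral_add (hp.const_mul l) (hq.div_const l), integral_const_mul,
          integral_div]
  rcases (abs_nonneg (∫ x, g x ∂μ)).eq_or_lt with hE | hE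
  · rw [← sq_abs, ← hE, zero_pow two_ne_zero]
    exact mul_nonneg hP hpos.le
  · have h1 := key _ (div_pos hpos hE)
    rw [div_div_cancel₀ hpos.ne', div_mul_eq_mul_div] at h1
    have h2 : |∫ x, g x ∂μ| ≤ ((∫ x, q x ∂μ) * ∫ x, p x ∂μ) / |∫ x, g x ∂μ| := by linarith
    rw [le_div_iff₀ hE] at h2
    rw [← sq_abs]
    linarith

/-- The defect in midpoint convexity of `(f, u) ↦ f² / u`, with an additional drop when the third
denominator exceeds the mean of the first two. -/
theorem midpoint_sq_div_gap {u₁ u₂ u : ℝ} (h₁ : 0 < u₁) (h₂ : 0 < u₂)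
    (hlo : (u₁ + u₂) / 2 ≤ u) (hhi : u ≤ u₁ + u₂) (f₁ f₂ : ℝ) :
    ((f₁ - f₂) / 2 - (u₁ - u₂) / 2 * ((f₁ + f₂) / (u₁ + u₂))) ^ 2 / ((u₁ + u₂) / 2) +
        ((f₁ + f₂) / (u₁ + u₂)) ^ 2 * (u - (u₁ + u₂) / 2) / 2 ≤
      (f₁ ^ 2 / u₁ + f₂ ^ 2 / u₂) / 2 - ((f₁ + f₂) / 2) ^ 2 / u := by
  set v := (u₁ + u₂) / 2 with hv
  set d := (f₁ - f₂) / 2 with hd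
  set e := (u₁ - u₂) / 2 with he
  set g := (f₁ + f₂) / (u₁ + u₂) with hg
  have hv0 : 0 < v := by positivity
  have hu0 : 0 < u := by linarith
  have hf : (f₁ + f₂) / 2 = g * v := by rw [hg, hv]; field_simp
  have e1 : u₁ = v + e := by rw [hv, he]; ring
  have e2 : u₂ = v - e := by rw [hv, he]; ring
  have e3 : f₁ = g * v + d := by rw [← hf, hd]; ring
  have e4 : f₂ = g * v - d := by rw [← hf, hd]; ring
  rw [hf]
  have hA : (f₁ ^ 2 / u₁ + f₂ ^ 2 / u₂) / 2 = g ^ 2 * v + (d - e * g) ^ 2 * (v / (u₁ * u₂)) := by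
    have hne₁ : v + e ≠ 0 := by rw [← e1]; exact h₁.ne'
    have hne₂ : v - e ≠ 0 := by rw [← e2]; exact h₂.ne'
    rw [e1, e2, e3, e4]
    field_simp
    ring
  have hB : 1 / v ≤ v / (u₁ * u₂) := by
    rw [div_le_div_iff₀ hv0 (by positivity), e1, e2]
    nlinarith [sq_nonneg e]
  have hC : g ^ 2 * (u - v) / 2 ≤ g ^ 2 * v - (g * v) ^ 2 / u := by
    have : g ^ 2 * v - (g * v) ^ 2 / u = g ^ 2 * (u - v) * (v / u) := by field_simp
    rw [this, div_eq_mul_one_div]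
    refine mul_le_mul_of_nonneg_left ?_ (mul_nonneg (sq_nonneg _) (by linarith))
    rw [div_le_div_iff₀ (by norm_num) hu0]
    linarith
  have hD := mul_le_mul_of_nonneg_left hB (sq_nonneg (d - e * g))
  rw [mul_one_div] at hD
  rw [hA]
  linarith

section Bellman

variable {Ψ : ℝ → ℝ}

theorem isDistFun_midpoint {N₁ N₂ : ℝ → ℝ} (h₁ : IsDistFun N₁) (h₂ : IsDistFun N₂) :
    IsDistFun fun t => (N₁ t + N₂ t) / 2 := by
  refine ⟨fun s hs t ht hst => ?_, fun t ht => ?_, (h₁.2.2.add h₂.2.2).div_const 2⟩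
  · have := h₁.1 hs ht hst
    have := h₂.1 hs ht hst
    simp only
    linarith
  · obtain ⟨a, b⟩ := h₁.2.1 t ht
    obtain ⟨c, d⟩ := h₂.2.1 t ht
    exact ⟨by linarith, by linarith⟩

theorem integrableOn_mFun_comp (hw : IntegrableOn (fun σ => (σ * Ψ σ)⁻¹) (Ioo 0 1))
    (h0 : ∀ σ ∈ Ioo (0:ℝ) 1, 0 ≤ (σ * Ψ σ)⁻¹)
    (h1 : ∫ σ in Ioo (0:ℝ) 1, (σ * Ψ σ)⁻¹ = 1) {N : ℝ → ℝ} (hN : IsDistFun N) :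
    IntegrableOn (fun t => mFun Ψ (N t)) (Ioi 0) := by
  have hi : IntegrableOn (fun t => secondPrimitive (fun σ => (σ * Ψ σ)⁻¹) (N t)) (Ioi 0) := by
    refine Integrable.mono' hN.2.2
      ((continuous_secondPrimitive hw h0 h1).comp_aestronglyMeasurable
        hN.2.2.aestronglyMeasurable) ?_
    refine (ae_restrict_mem measurableSet_Ioi).mono fun t ht => ?_
    have hNt := (hN.2.1 t (le_of_lt ht)).1
    have hlo := secondPrimitive_mono hw h0 hNt
    have hhi := secondPrimitive_sub_le hw h0 h1 hNt
    rw [secondPrimitive_zero] at hlo hhi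
    rw [Real.norm_eq_abs, abs_of_nonneg hlo]
    linarith
  refine hi.congr_fun (fun t ht => ?_) measurableSet_Ioi
  exact (mFun_eq_secondPrimitive Ψ (hN.2.1 t (le_of_lt ht)).2).symm

end Bellman

/-- the two-point (dyadic) form of the main Bellman inequality (3.9). -/
theorem statement6 (Ψ : ℝ → ℝ)
    (hΨpos : ∀ s ∈ Set.Ioc (0:ℝ) 1, 0 < Ψ s)
    (hΨdec : AntitoneOn Ψ (Set.Ioc (0:ℝ) 1))
    (hφinc : MonotoneOn (fun s => s * Ψ s) (Set.Ioc (0:ℝ) 1))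
    (hnorm : (∫ s in Set.Ioo (0:ℝ) 1, (s * Ψ s)⁻¹) = 1) :
    ∃ c : ℝ, 0 < c ∧
      ∀ N₁ N₂ : ℝ → ℝ, IsDistFun N₁ → IsDistFun N₂ →
        (0 < ∫ t in Set.Ioi (0:ℝ), N₁ t) → (0 < ∫ t in Set.Ioi (0:ℝ), N₂ t) →
        ∀ f₁ f₂ : ℝ,
          c / 4 * (f₁ - (f₁ + f₂) / 2) ^ 2 / nPsi Ψ (fun t => (N₁ t + N₂ t) / 2) ≤
            (Btilde Ψ f₁ N₁ + Btilde Ψ f₂ N₂) / 2 -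
              Btilde Ψ ((f₁ + f₂) / 2) (fun t => (N₁ t + N₂ t) / 2) := by
  have hφpos : ∀ s ∈ Ioc (0:ℝ) 1, 0 < s * Ψ s := fun s hs => mul_pos hs.1 (hΨpos s hs)
  have hw : IntegrableOn (fun σ => (σ * Ψ σ)⁻¹) (Ioo 0 1) := by
    by_contra h
    rw [integral_undef h] at hnorm
    norm_num at hnorm
  have h0 : ∀ σ ∈ Ioo (0:ℝ) 1, 0 ≤ (σ * Ψ σ)⁻¹ := fun σ hσ =>
    inv_nonneg.2 (hφpos σ ⟨hσ.1, hσ.2.le⟩).le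
  have hΨ1 : 0 < Ψ 1 := hΨpos 1 (by simp)
  refine ⟨4 / (4 / Ψ 1 + 64), by positivity, fun N₁ N₂ hN₁ hN₂ hp₁ hp₂ f₁ f₂ => ?_⟩
  set M := secondPrimitive fun σ => (σ * Ψ σ)⁻¹ with hM
  have hN := isDistFun_midpoint hN₁ hN₂
  set N : ℝ → ℝ := fun t => (N₁ t + N₂ t) / 2 with hNdef
  have hm : ∀ {s : ℝ}, s ≤ 1 → mFun Ψ s = M s := mFun_eq_secondPrimitive Ψ
  have hi₁ := integrableOn_mFun_comp hw h0 hnorm hN₁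
  have hi₂ := integrableOn_mFun_comp hw h0 hnorm hN₂
  have hi := integrableOn_mFun_comp hw h0 hnorm hN
  have hj₁ : IntegrableOn (fun t => 2 * N₁ t - mFun Ψ (N₁ t)) (Ioi 0) :=
    (hN₁.2.2.const_mul 2).sub hi₁
  have hj₂ : IntegrableOn (fun t => 2 * N₂ t - mFun Ψ (N₂ t)) (Ioi 0) :=
    (hN₂.2.2.const_mul 2).sub hi₂
  have hj : IntegrableOn (fun t => 2 * N t - mFun Ψ (N t)) (Ioi 0) :=
    (hN.2.2.const_mul 2).sub hi
  have hm_bounds : ∀ s ∈ Icc (0:ℝ) 1, 0 ≤ mFun Ψ s ∧ mFun Ψ s ≤ s := by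
    intro s hs
    have hlo := secondPrimitive_mono hw h0 hs.1
    have hhi := secondPrimitive_sub_le hw h0 hnorm hs.1
    rw [secondPrimitive_zero, ← hM, ← hm hs.2] at hlo hhi
    exact ⟨hlo, by linarith⟩
  have hu_lower : ∀ {K : ℝ → ℝ}, IsDistFun K → ∫ t in Ioi (0:ℝ), K t ≤ uFun Ψ K := by
    intro K hK
    refine setIntegral_mono_on hK.2.2
      ((hK.2.2.const_mul 2).sub (integrableOn_mFun_comp hw h0 hnorm hK)) measurableSet_Ioi
      fun t ht => ?_
    linarith [(hm_bounds _ (hK.2.1 t (le_of_lt ht))).2]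
  have hu₁ := hp₁.trans_le (hu_lower hN₁)
  have hu₂ := hp₂.trans_le (hu_lower hN₂)
  have hNint : ∫ t in Ioi (0:ℝ), N t =
      ((∫ t in Ioi (0:ℝ), N₁ t) + ∫ t in Ioi (0:ℝ), N₂ t) / 2 := by
    rw [integral_div, integral_add hN₁.2.2 hN₂.2.2]
  have hu_upper : ∀ {K : ℝ → ℝ}, IsDistFun K → uFun Ψ K ≤ 2 * ∫ t in Ioi (0:ℝ), K t := by
    intro K hK
    rw [← integral_const_mul]
    refine setIntegral_mono_on
      ((hK.2.2.const_mul 2).sub (integrableOn_mFun_comp hw h0 hnorm hK)) (hK.2.2.const_mul 2)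
      measurableSet_Ioi fun t ht => ?_
    linarith [(hm_bounds _ (hK.2.1 t (le_of_lt ht))).1]
  have hu_hi : uFun Ψ N ≤ uFun Ψ N₁ + uFun Ψ N₂ := by
    linarith [hu_upper hN, hu_lower hN₁, hu_lower hN₂]
  have hgap_int : IntegrableOn
      (fun t => (mFun Ψ (N₁ t) + mFun Ψ (N₂ t)) / 2 - mFun Ψ (N t)) (Ioi 0) :=
    ((hi₁.add hi₂).div_const 2).sub hi
  have hgap : uFun Ψ N - (uFun Ψ N₁ + uFun Ψ N₂) / 2 =
      ∫ t in Ioi (0:ℝ), ((mFun Ψ (N₁ t) + mFun Ψ (N₂ t)) / 2 - mFun Ψ (N t)) := by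
    have hjm : IntegrableOn (fun t => ((2 * N₁ t - mFun Ψ (N₁ t)) +
        (2 * N₂ t - mFun Ψ (N₂ t))) / 2) (Ioi 0) := (hj₁.add hj₂).div_const 2
    simp only [uFun]
    rw [← integral_add hj₁ hj₂, ← integral_div, ← integral_sub hj hjm]
    refine setIntegral_congr_fun measurableSet_Ioi fun t _ => ?_
    simp only [hNdef]
    ring
  have hmid : ∀ a ∈ Icc (0:ℝ) 1, ∀ b ∈ Icc (0:ℝ) 1, ∀ k : ℝ,
      (∀ σ ∈ Ioo (0:ℝ) ((a + b) / 2), k ≤ (σ * Ψ σ)⁻¹) →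
      k * ((a - b) / 2) ^ 2 / 4 ≤ (mFun Ψ a + mFun Ψ b) / 2 - mFun Ψ ((a + b) / 2) := by
    intro a ha b hb k hk
    rw [hm ha.2, hm hb.2, hm (by linarith [ha.2, hb.2])]
    rcases le_total a b with hab | hab
    · have := le_secondPrimitive_midpoint_gap hw h0 ha.1 hab hb.2
        fun σ hσ => hk σ ⟨ha.1.trans_lt hσ.1, hσ.2⟩
      rw [← hM] at this
      linarith
    · rw [add_comm a b] at hk ⊢
      have := le_secondPrimitive_midpoint_gap hw h0 hb.1 hab ha.2
        fun σ hσ => hk σ ⟨hb.1.trans_lt hσ.1, hσ.2⟩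
      rw [← hM] at this
      linarith
  have hgap0 : ∀ t ∈ Ioi (0:ℝ), 0 ≤ (mFun Ψ (N₁ t) + mFun Ψ (N₂ t)) / 2 - mFun Ψ (N t) := by
    intro t ht
    have hNt := hN.2.1 t (le_of_lt ht)
    have := hmid _ (hN₁.2.1 t (le_of_lt ht)) _ (hN₂.2.1 t (le_of_lt ht)) 0
      fun σ hσ => h0 σ ⟨hσ.1, hσ.2.trans_le hNt.2⟩
    simpa using this
  have hD0 : 0 ≤ uFun Ψ N - (uFun Ψ N₁ + uFun Ψ N₂) / 2 := by
    rw [hgap]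
    exact setIntegral_nonneg measurableSet_Ioi hgap0
  have hmain := midpoint_sq_div_gap hu₁ hu₂ (by linarith) hu_hi f₁ f₂
  change _ ≤ (f₁ ^ 2 / uFun Ψ N₁ + f₂ ^ 2 / uFun Ψ N₂) / 2 - ((f₁ + f₂) / 2) ^ 2 / uFun Ψ N
  refine le_trans ?_ hmain
  have hd : f₁ - (f₁ + f₂) / 2 = (f₁ - f₂) / 2 := by ring
  rw [hd]
  set g := (f₁ + f₂) / (uFun Ψ N₁ + uFun Ψ N₂)
  set d := (f₁ - f₂) / 2
  set v := (uFun Ψ N₁ + uFun Ψ N₂) / 2 with hv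
  set e := (uFun Ψ N₁ - uFun Ψ N₂) / 2
  set D := uFun Ψ N - v
  have hv0 : 0 < v := by positivity
  by_cases hF : IntegrableOn (fun t => if N t = 0 then 0 else N t * Ψ (N t)) (Ioi 0)
  swap
  · have : nPsi Ψ N = 0 := integral_undef hF
    rw [this, div_zero]
    positivity
  have hΨN : Ψ 1 * ∫ t in Ioi (0:ℝ), N t ≤ nPsi Ψ N := by
    rw [← integral_const_mul]
    refine setIntegral_mono_on (hN.2.2.const_mul _) hF measurableSet_Ioi fun t ht => ?_
    obtain ⟨hlo, hhi⟩ := hN.2.1 t (le_of_lt ht)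
    split_ifs with hNt
    · rw [hNt, mul_zero]
    · have hpos : 0 < N t := lt_of_le_of_ne hlo (Ne.symm hNt)
      rw [mul_comm]
      exact mul_le_mul_of_nonneg_left (hΨdec ⟨hpos, hhi⟩ (by simp) hhi) hlo
  have hn : 0 < nPsi Ψ N := by
    refine lt_of_lt_of_le (mul_pos hΨ1 ?_) hΨN
    rw [hNint]
    positivity
  have hvn : v ≤ 2 / Ψ 1 * nPsi Ψ N := by
    have h3 : v ≤ 2 * ∫ t in Ioi (0:ℝ), N t := by
      linarith [hu_upper hN₁, hu_upper hN₂]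
    rw [div_mul_eq_mul_div, le_div_iff₀ hΨ1]
    nlinarith
  have hsq : (∫ t in Ioi (0:ℝ), |(N₁ t - N₂ t) / 2|) ^ 2 ≤ 4 * D * nPsi Ψ N := by
    rw [hgap, ← integral_const_mul]
    refine sq_integral_le_of_sq_le_mul ((hN₁.2.2.sub hN₂.2.2).div_const 2).abs
      (hgap_int.const_mul 4) hF ?_ ?_ ?_ hn
    · filter_upwards [ae_restrict_mem measurableSet_Ioi] with t ht
      exact mul_nonneg (by norm_num) (hgap0 t ht)
    · filter_upwards [ae_restrict_mem measurableSet_Ioi] with t ht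
      obtain ⟨hlo, hhi⟩ := hN.2.1 t (le_of_lt ht)
      simp only [Pi.zero_apply]
      split_ifs with hNt
      · exact le_rfl
      · exact (hφpos _ ⟨lt_of_le_of_ne hlo (Ne.symm hNt), hhi⟩).le
    · filter_upwards [ae_restrict_mem measurableSet_Ioi] with t ht
      obtain ⟨hlo, hhi⟩ := hN.2.1 t (le_of_lt ht)
      have hN₁t := hN₁.2.1 t (le_of_lt ht)
      have hN₂t := hN₂.2.1 t (le_of_lt ht)
      rw [sq_abs]
      split_ifs with hNt
      · have hsum : N₁ t + N₂ t = 0 := by simpa [hNdef] using hNt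
        have : N₁ t = 0 := by linarith [hN₁t.1, hN₂t.1]
        have : N₂ t = 0 := by linarith
        simp [*]
      · have hpos : 0 < N t := lt_of_le_of_ne hlo (Ne.symm hNt)
        have hφN := hφpos _ ⟨hpos, hhi⟩
        have h4 := hmid _ hN₁t _ hN₂t (N t * Ψ (N t))⁻¹ fun σ hσ =>
          inv_anti₀ (hφpos σ ⟨hσ.1, hσ.2.le.trans hhi⟩)
            (hφinc ⟨hσ.1, hσ.2.le.trans hhi⟩ ⟨hpos, hhi⟩ hσ.2.le)
        rw [← div_le_iff₀ hφN]
        change _ ≤ (mFun Ψ (N₁ t) + mFun Ψ (N₂ t)) / 2 - mFun Ψ (N t) at h4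
        rw [div_eq_mul_inv]
        linarith
  have hen : e ^ 2 ≤ 16 * D * nPsi Ψ N := by
    have h5 : |e| ≤ 2 * ∫ t in Ioi (0:ℝ), |(N₁ t - N₂ t) / 2| := by
      have h6 : e = ∫ t in Ioi (0:ℝ),
          ((2 * N₁ t - mFun Ψ (N₁ t)) - (2 * N₂ t - mFun Ψ (N₂ t))) / 2 := by
        rw [integral_div, integral_sub hj₁ hj₂]
        rfl
      rw [h6, ← integral_const_mul]
      refine abs_integral_le_integral_abs.trans ?_
      refine setIntegral_mono_on ((hj₁.sub hj₂).div_const 2).abs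
        (((hN₁.2.2.sub hN₂.2.2).div_const 2).abs.const_mul 2) measurableSet_Ioi fun t ht => ?_
      have hlip : ∀ a b : ℝ, a ≤ b → b ≤ 1 → 0 ≤ mFun Ψ b - mFun Ψ a ∧
          mFun Ψ b - mFun Ψ a ≤ b - a := by
        intro a b hab hb
        rw [hm hb, hm (hab.trans hb)]
        exact ⟨sub_nonneg.2 (secondPrimitive_mono hw h0 hab),
          secondPrimitive_sub_le hw h0 hnorm hab⟩
      rcases le_total (N₁ t) (N₂ t) with h | h
      · have h7 := hlip _ _ h (hN₂.2.1 t (le_of_lt ht)).2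
        rw [abs_of_nonpos (by linarith), abs_of_nonpos (by linarith)]
        linarith
      · have h7 := hlip _ _ h (hN₁.2.1 t (le_of_lt ht)).2
        rw [abs_of_nonneg (by linarith), abs_of_nonneg (by linarith)]
        linarith
    have h8 := pow_le_pow_left₀ (abs_nonneg e) h5 2
    rw [sq_abs, mul_pow] at h8
    linarith
  have hX : (d - e * g) ^ 2 ≤ 2 / Ψ 1 * nPsi Ψ N * ((d - e * g) ^ 2 / v) := by
    calc (d - e * g) ^ 2 = v * ((d - e * g) ^ 2 / v) := (mul_div_cancel₀ _ hv0.ne').symm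
      _ ≤ _ := mul_le_mul_of_nonneg_right hvn (by positivity)
  have hY : (e * g) ^ 2 ≤ 32 * nPsi Ψ N * (g ^ 2 * D / 2) := by
    rw [mul_pow]
    linarith [mul_le_mul_of_nonneg_right hen (sq_nonneg g)]
  have hA0 : 0 ≤ (d - e * g) ^ 2 / v := by positivity
  have hB0 : 0 ≤ g ^ 2 * D / 2 := by positivity
  rw [div_le_iff₀ hn, div_div_cancel_left' (by norm_num), inv_mul_le_iff₀ (by positivity)]
  have hd2 : d ^ 2 ≤ 2 * (d - e * g) ^ 2 + 2 * (e * g) ^ 2 := by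
    linarith [sq_nonneg (d - 2 * (e * g))]
  have hK : 4 / Ψ 1 = 2 * (2 / Ψ 1) := by ring
  have hK0 : 0 < 2 / Ψ 1 := by positivity
  rw [hK]
  have h9 := mul_nonneg (mul_nonneg hK0.le hn.le) hB0
  have h10 := mul_nonneg hn.le hA0
  linarith
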